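/- Let g be a non-negative monotone submodular set function on a finite set U with g(∅) = 0, d a metric distance on U, D the sum-sum diversity of d, f = g + D, k ≥ 10 and m ≥ 1. Let (T¹,…,Tᵐ) be a uniformly random m-partition of U, let Sⁱ = ALG(Tⁱ) be the output of the greedy algorithm (Algorithm 1, with consistent tiebreaking) on each part, let O be a k-subset of U maximizing f over all k-subsets of U, and let OPT(∪_i Sⁱ) be a k-subset of ∪_{i=1}^m Sⁱ maximizing f. Then g(O) ≤ 7·E[f(OPT(∪_{i=1}^m Sⁱ))], and combined with D(O) ≤ 8.5·f(OPT(∪_{i=1}^m Sⁱ)) (which holds for every realization of the partition), f(O) ≤ 15.5·E[f(OPT(∪_{i=1}^m Sⁱ))]. -/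

import Mathlib

open Finset

/-- Sum-sum diversity: the sum of `d u v` over all unordered pairs of distinct
elements of `S` (each unordered pair counted once). -/
noncomputable def sumsumDiv {α : Type*} [DecidableEq α] (d : α → α → ℝ) (S : Finset α) : ℝ :=
  (∑ p ∈ S.offDiag, d p.1 p.2) / 2

/-- The marginal gain used by the greedy algorithm:
`gain g d S u = Δ(u, S) + ∑_{x ∈ S} d x u`. -/
noncomputable def gain {α : Type*} [DecidableEq α] (g : Finset α → ℝ) (d : α → α → ℝ)
    (S : Finset α) (u : α) : ℝ :=
  (g (insert u S) - g S) + ∑ x ∈ S, d x u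

open scoped Classical in
/-- Pick, among the elements of `C`, the one maximizing `h` with ties broken by a fixed
a-priori linear ordering (the earliest maximizer); returns it as a singleton set,
or `∅` if `C = ∅`. -/
noncomputable def pick {α : Type*} [LinearOrder α] (h : α → ℝ) (C : Finset α) : Finset α :=
  if hne : (C.filter fun u => ∀ v ∈ C, h v ≤ h u).Nonempty then
    {(C.filter fun u => ∀ v ∈ C, h v ≤ h u).min' hne}
  else ∅

open scoped Classical in
/-- `greedy g d n T` is the set selected after `n` steps of Algorithm 1 (Greedy) on the
ground set `T`: at each step it adds the element of `T` maximizing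
`Δ(u, S) + ∑_{x ∈ S} d x u`, with ties broken consistently by a fixed a-priori ordering. -/
noncomputable def greedy {α : Type*} [LinearOrder α] (g : Finset α → ℝ) (d : α → α → ℝ) :
    ℕ → Finset α → Finset α
  | 0, _ => ∅
  | n + 1, T =>
      let S := greedy g d n T
      S ∪ pick (gain g d S) (T \ S)

/-- Part `i` of the partition of the finite ground set induced by the assignment `π`. -/
def part {α : Type*} [Fintype α] {m : ℕ} (π : α → Fin m) (i : Fin m) : Finset α :=
  Finset.univ.filter fun a => π a = i

/-- Expectation of `F` over a uniformly random `m`-partition of the finite ground set,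
i.e. over a uniformly random assignment `π` of each element independently and uniformly
to one of the `m` parts. -/
noncomputable def expVal {α : Type*} [Fintype α] [DecidableEq α] (m : ℕ)
    (F : (α → Fin m) → ℝ) : ℝ :=
  (∑ π : α → Fin m, F π) / (m : ℝ) ^ (Fintype.card α)

section Diversity

variable {α : Type*} [DecidableEq α] {d : α → α → ℝ}

lemma sumsumDiv_eq_sum_sum (hd0 : ∀ u, d u u = 0) (S : Finset α) :
    sumsumDiv d S = (∑ x ∈ S, ∑ y ∈ S, d x y) / 2 := by
  unfold sumsumDiv
  rw [← Finset.sum_product', ← Finset.diag_union_offDiag,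
    Finset.sum_union (Finset.disjoint_diag_offDiag S)]
  have : ∑ p ∈ S.diag, d p.1 p.2 = 0 := by
    refine Finset.sum_eq_zero fun p hp => ?_
    rw [Finset.mem_diag] at hp
    rw [← hp.2, hd0]
  rw [this, zero_add]

lemma sumsumDiv_nonneg (hdnn : ∀ u v, 0 ≤ d u v) (S : Finset α) : 0 ≤ sumsumDiv d S :=
  div_nonneg (Finset.sum_nonneg fun _ _ => hdnn _ _) (by norm_num)

lemma sumsumDiv_insert (hd0 : ∀ u, d u u = 0) (hdsymm : ∀ u v, d u v = d v u)
    {S : Finset α} {u : α} (hu : u ∉ S) :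
    sumsumDiv d (insert u S) = sumsumDiv d S + ∑ x ∈ S, d x u := by
  rw [sumsumDiv_eq_sum_sum hd0, sumsumDiv_eq_sum_sum hd0]
  simp only [Finset.sum_insert hu, Finset.sum_add_distrib, hd0]
  rw [Finset.sum_congr rfl fun x _ => hdsymm u x]
  ring

/-- Moving the points of a set injectively changes its diversity by at most the total
displacement times the cardinality. -/
lemma sumsumDiv_le_of_injOn (hd0 : ∀ u, d u u = 0) (hdsymm : ∀ u v, d u v = d v u)
    (hdtri : ∀ u v w, d u w ≤ d u v + d v w) {O : Finset α} {h : α → α}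
    (hinj : Set.InjOn h O) :
    sumsumDiv d O ≤ O.card * (∑ o ∈ O, d o (h o)) + sumsumDiv d (O.image h) := by
  rw [sumsumDiv_eq_sum_sum hd0, sumsumDiv_eq_sum_sum hd0, Finset.sum_image hinj]
  simp only [Finset.sum_image hinj]
  have key : ∑ x ∈ O, ∑ y ∈ O, d x y
      ≤ ∑ x ∈ O, ∑ y ∈ O, (d x (h x) + d (h x) (h y) + d y (h y)) := by
    refine Finset.sum_le_sum fun x _ => Finset.sum_le_sum fun y _ => ?_
    linarith [hdtri x (h x) y, hdtri (h x) (h y) y, hdsymm y (h y)]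
  simp only [Finset.sum_add_distrib, Finset.sum_const, nsmul_eq_mul] at key
  rw [← Finset.mul_sum] at key
  linarith

end Diversity

section Submodular

variable {α : Type*} [DecidableEq α] {g : Finset α → ℝ}

/-- Lower additive bounds: a normalized submodular function dominates a modular one that
agrees with it on a prescribed set. -/
lemma exists_modular_le
    (hgsub : ∀ A B : Finset α, A ⊆ B → ∀ y ∉ B,
      g (insert y B) - g B ≤ g (insert y A) - g A)
    (hg0 : g ∅ = 0) (O : Finset α) :
    ∃ δ : α → ℝ, ∑ o ∈ O, δ o = g O ∧ ∀ A ⊆ O, ∑ o ∈ A, δ o ≤ g A := by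
  induction O using Finset.induction_on with
  | empty =>
    refine ⟨0, by simp [hg0], fun A hA => ?_⟩
    rw [Finset.subset_empty.1 hA]
    simp [hg0]
  | insert x O hx ih =>
    obtain ⟨δ, h1, h2⟩ := ih
    refine ⟨Function.update δ x (g (insert x O) - g O), ?_, fun A hA => ?_⟩
    · rw [Finset.sum_insert hx, Finset.sum_update_of_notMem hx, h1]
      simp
    · by_cases hxA : x ∈ A
      · have hsub : A.erase x ⊆ O := Finset.subset_insert_iff.1 hA
        rw [← Finset.insert_erase hxA, Finset.sum_insert (Finset.notMem_erase x A),
          Finset.sum_update_of_notMem (Finset.notMem_erase x A)]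
        have := hgsub _ _ hsub x hx
        have := h2 _ hsub
        simp only [Function.update_self]
        linarith
      · rw [Finset.sum_update_of_notMem hxA]
        exact h2 A ((Finset.subset_insert_iff_of_notMem hxA).1 hA)

lemma union_le_add_sum_marginal
    (hgmono : ∀ A B : Finset α, A ⊆ B → g A ≤ g B)
    (hgsub : ∀ A B : Finset α, A ⊆ B → ∀ y ∉ B,
      g (insert y B) - g B ≤ g (insert y A) - g A)
    (S R : Finset α) :
    g (S ∪ R) ≤ g S + ∑ o ∈ R, (g (insert o S) - g S) := by
  induction R using Finset.induction_on with
  | empty => simp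
  | insert x R hx ih =>
    rw [Finset.sum_insert hx, Finset.union_insert]
    by_cases hxS : x ∈ S ∪ R
    · rw [Finset.insert_eq_of_mem hxS]
      linarith [hgmono _ _ (Finset.subset_insert x S)]
    · linarith [hgsub S (S ∪ R) Finset.subset_union_left x hxS]

end Submodular

/-- An injection whose cost is at most the average cost. -/
lemma exists_injOn_card_mul_sum_le {α : Type*} (B S : Finset α)
    (c : α → α → ℝ) (hcard : B.card ≤ S.card) (hS : S.Nonempty) :
    ∃ h : α → α, Set.InjOn h B ∧ (∀ o ∈ B, h o ∈ S) ∧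
      S.card * ∑ o ∈ B, c o (h o) ≤ ∑ o ∈ B, ∑ s ∈ S, c o s := by
  classical
  have hpos : 0 < S.card := hS.card_pos
  have : NeZero S.card := ⟨hpos.ne'⟩
  let e := S.equivFin
  obtain ⟨i, hi⟩ : ∃ i : α → Fin S.card, Set.InjOn i B := by
    refine ⟨fun o => if ho : o ∈ B then Fin.castLE hcard (B.equivFin ⟨o, ho⟩) else 0, ?_⟩
    intro x hx y hy hxy
    rw [Finset.mem_coe] at hx hy
    simp only [hx, hy, dif_pos] at hxy
    simpa using (Fin.castLE_injective hcard hxy)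
  have hsum : ∑ t : Fin S.card, ∑ o ∈ B, c o (e.symm (i o + t))
      = ∑ o ∈ B, ∑ s ∈ S, c o s := by
    rw [Finset.sum_comm]
    refine Finset.sum_congr rfl fun o _ => ?_
    rw [← Finset.sum_coe_sort S]
    exact Equiv.sum_comp ((Equiv.addLeft (i o)).trans e.symm) (fun s : S => c o s)
  obtain ⟨t, -, ht⟩ := Finset.exists_le_of_sum_le (s := (Finset.univ : Finset (Fin S.card)))
    (f := fun t => ∑ o ∈ B, c o (e.symm (i o + t)))
    (g := fun _ => (∑ o ∈ B, ∑ s ∈ S, c o s) / S.card) Finset.univ_nonempty (by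
      rw [hsum, Finset.sum_const, Finset.card_univ, Fintype.card_fin, nsmul_eq_mul,
        mul_div_cancel₀]
      exact_mod_cast hpos.ne')
  refine ⟨fun o => e.symm (i o + t), ?_, fun o _ => (e.symm _).2, ?_⟩
  · intro x hx y hy hxy
    have := e.symm.injective (Subtype.ext hxy)
    exact hi hx hy (add_right_cancel this)
  · rw [le_div_iff₀ (by exact_mod_cast hpos)] at ht
    linarith

section Greedy

variable {α : Type*} [LinearOrder α] {g : Finset α → ℝ} {d : α → α → ℝ}

lemma pick_subset (h : α → ℝ) (C : Finset α) : pick h C ⊆ C := by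
  unfold pick
  split_ifs with hne
  · rw [Finset.singleton_subset_iff]
    exact (Finset.mem_filter.1 (Finset.min'_mem _ hne)).1
  · exact Finset.empty_subset _

lemma exists_pick_eq_singleton (h : α → ℝ) {C : Finset α} (hC : C.Nonempty) :
    ∃ s ∈ C, pick h C = {s} ∧ ∀ v ∈ C, h v ≤ h s := by
  classical
  have hne : (C.filter fun u => ∀ v ∈ C, h v ≤ h u).Nonempty := by
    obtain ⟨u, hu, hmax⟩ := C.exists_max_image h hC
    exact ⟨u, Finset.mem_filter.2 ⟨hu, hmax⟩⟩
  have hmem := Finset.mem_filter.1 (Finset.min'_mem _ hne)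
  refine ⟨_, hmem.1, ?_, hmem.2⟩
  unfold pick
  rw [dif_pos (by convert hne)]

lemma pick_insert_of_notMem (h : α → ℝ) {C : Finset α} {o : α}
    (ho : o ∉ pick h (insert o C)) : pick h (insert o C) = pick h C := by
  classical
  by_cases hoC : o ∈ C
  · rw [Finset.insert_eq_of_mem hoC]
  obtain ⟨s, hs, hps, hmax⟩ := exists_pick_eq_singleton h (Finset.insert_nonempty o C)
  have hso : s ≠ o := by
    rintro rfl
    exact ho (by rw [hps]; exact Finset.mem_singleton_self _)
  have hsC : s ∈ C := Finset.mem_of_mem_insert_of_ne hs hso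
  obtain ⟨t, ht, hpt, htmax⟩ := exists_pick_eq_singleton h ⟨s, hsC⟩
  have hst : h s = h t := le_antisymm (htmax s hsC) (hmax t (Finset.mem_insert_of_mem ht))
  have le_of_max : ∀ (E : Finset α) (a b : α), pick h E = {a} → b ∈ E →
      (∀ v ∈ E, h v ≤ h b) → a ≤ b := by
    intro E a b hE hb hbm
    unfold pick at hE
    split_ifs at hE with hne
    · rw [Finset.singleton_inj] at hE
      rw [← hE]
      exact Finset.min'_le _ _ (Finset.mem_filter.2 ⟨hb, hbm⟩)
    · exact absurd hE.symm (Finset.singleton_ne_empty a)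
  rw [hps, hpt, Finset.singleton_inj]
  refine le_antisymm (le_of_max _ _ _ hps (Finset.mem_insert_of_mem ht) ?_)
    (le_of_max _ _ _ hpt hsC ?_)
  · intro v hv
    rw [← hst]
    exact hmax v hv
  · intro v hv
    exact hmax v (Finset.mem_insert_of_mem hv)

lemma greedy_succ (n : ℕ) (T : Finset α) :
    greedy g d (n + 1) T
      = greedy g d n T ∪ pick (gain g d (greedy g d n T)) (T \ greedy g d n T) := rfl

lemma greedy_subset (n : ℕ) (T : Finset α) : greedy g d n T ⊆ T := by
  induction n with
  | zero => exact Finset.empty_subset _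
  | succ n ih =>
    rw [greedy_succ]
    exact Finset.union_subset ih ((pick_subset _ _).trans Finset.sdiff_subset)

lemma greedy_mono {n k : ℕ} (h : n ≤ k) (T : Finset α) : greedy g d n T ⊆ greedy g d k T := by
  induction k, h using Nat.le_induction with
  | base => exact subset_rfl
  | succ k _ ih =>
    rw [greedy_succ]
    exact ih.trans Finset.subset_union_left

lemma exists_greedy_succ_eq_insert {n : ℕ} {T : Finset α} {o : α} (hoT : o ∈ T)
    (ho : o ∉ greedy g d n T) :
    ∃ s ∉ greedy g d n T, greedy g d (n + 1) T = insert s (greedy g d n T) ∧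
      gain g d (greedy g d n T) o ≤ gain g d (greedy g d n T) s := by
  have hmem : o ∈ T \ greedy g d n T := Finset.mem_sdiff.2 ⟨hoT, ho⟩
  obtain ⟨s, hs, hps, hmax⟩ := exists_pick_eq_singleton (gain g d (greedy g d n T)) ⟨o, hmem⟩
  refine ⟨s, (Finset.mem_sdiff.1 hs).2, ?_, hmax o hmem⟩
  rw [greedy_succ, hps, Finset.union_comm, Finset.insert_eq]

lemma card_greedy_of_notMem {n : ℕ} {T : Finset α} {o : α} (hoT : o ∈ T)
    (ho : o ∉ greedy g d n T) : (greedy g d n T).card = n := by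
  induction n with
  | zero => rfl
  | succ n ih =>
    have ho' := fun h => ho (greedy_mono n.le_succ T h)
    obtain ⟨s, hs, heq, -⟩ := exists_greedy_succ_eq_insert hoT ho'
    rw [heq, Finset.card_insert_of_notMem hs, ih ho']

/-- Consistency: an element that would be rejected does not influence the greedy output. -/
lemma greedy_insert_of_notMem {n : ℕ} {T : Finset α} {o : α}
    (ho : o ∉ greedy g d n (insert o T)) : greedy g d n (insert o T) = greedy g d n T := by
  induction n with
  | zero => rfl
  | succ n ih =>
    have ho' := fun h => ho (greedy_mono n.le_succ _ h)
    have hn := ih ho'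
    rw [greedy_succ] at ho
    rw [greedy_succ, greedy_succ]
    rw [hn] at ho ho' ⊢
    rw [Finset.insert_sdiff_of_notMem _ ho'] at ho ⊢
    rw [pick_insert_of_notMem _ fun h => ho (Finset.mem_union_right _ h)]

lemma sum_gain_le_of_notMem (hg0 : g ∅ = 0) (hd0 : ∀ u, d u u = 0)
    (hdsymm : ∀ u v, d u v = d v u) {n : ℕ} {T : Finset α} {o : α} (hoT : o ∈ T)
    (ho : o ∉ greedy g d n T) :
    ∑ j ∈ Finset.range n, gain g d (greedy g d j T) o
      ≤ g (greedy g d n T) + sumsumDiv d (greedy g d n T) := by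
  induction n with
  | zero => simp [greedy, hg0, sumsumDiv]
  | succ n ih =>
    have ho' := fun h => ho (greedy_mono n.le_succ T h)
    obtain ⟨s, hs, heq, hle⟩ := exists_greedy_succ_eq_insert hoT ho'
    rw [Finset.sum_range_succ, heq, sumsumDiv_insert hd0 hdsymm hs]
    have hgain : gain g d (greedy g d n T) s = (g (insert s (greedy g d n T))
      - g (greedy g d n T)) + ∑ x ∈ greedy g d n T, d x s := rfl
    linarith [ih ho']

lemma mul_marginal_le_of_notMem
    (hgsub : ∀ A B : Finset α, A ⊆ B → ∀ y ∉ B,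
      g (insert y B) - g B ≤ g (insert y A) - g A)
    (hg0 : g ∅ = 0) (hd0 : ∀ u, d u u = 0) (hdnn : ∀ u v, 0 ≤ d u v)
    (hdsymm : ∀ u v, d u v = d v u) {k : ℕ} {T : Finset α} {o : α} (hoT : o ∈ T)
    (ho : o ∉ greedy g d k T) :
    k * (g (insert o (greedy g d k T)) - g (greedy g d k T))
      ≤ g (greedy g d k T) + sumsumDiv d (greedy g d k T) := by
  refine le_trans ?_ (sum_gain_le_of_notMem hg0 hd0 hdsymm hoT ho)
  rw [← nsmul_eq_mul, ← Finset.card_range k, ← Finset.sum_const, Finset.card_range]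
  refine Finset.sum_le_sum fun j hj => ?_
  have h1 := hgsub _ _ (greedy_mono (g := g) (d := d) (Finset.mem_range.1 hj).le T) o ho
  have h2 : 0 ≤ ∑ x ∈ greedy g d j T, d x o := Finset.sum_nonneg fun _ _ => hdnn _ _
  unfold gain
  linarith

/-- The greedy set is, on average, close to every rejected element. -/
lemma mul_sum_dist_le_of_notMem
    (hgnn : ∀ S : Finset α, 0 ≤ g S)
    (hgmono : ∀ A B : Finset α, A ⊆ B → g A ≤ g B)
    (hg0 : g ∅ = 0) (hd0 : ∀ u, d u u = 0) (hdnn : ∀ u v, 0 ≤ d u v)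
    (hdsymm : ∀ u v, d u v = d v u) (hdtri : ∀ u v w, d u w ≤ d u v + d v w)
    {k : ℕ} {T : Finset α} {o : α} (hoT : o ∈ T) (ho : o ∉ greedy g d k T) :
    (k - 1) * ∑ x ∈ greedy g d k T, d x o
      ≤ 6 * (g (greedy g d k T) + sumsumDiv d (greedy g d k T)) := by
  set S := greedy g d k T with hS
  have hcard : S.card = k := card_greedy_of_notMem hoT ho
  have hD := sumsumDiv_nonneg hdnn S
  rcases Nat.eq_zero_or_pos k with hk | hk
  · have : S = ∅ := Finset.card_eq_zero.1 (hcard.trans hk)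
    rw [this]
    simp [hg0, sumsumDiv]
  have hkpos : (0 : ℝ) < k := by exact_mod_cast hk
  have step : ∀ j ∈ Finset.range k, (j : ℝ) * ∑ x ∈ S, d x o
      ≤ 2 * sumsumDiv d S + k * gain g d (greedy g d j T) o := by
    intro j hj
    have hjk : j ≤ k := (Finset.mem_range.1 hj).le
    have hsub : greedy g d j T ⊆ S := greedy_mono hjk T
    have hcj : (greedy g d j T).card = j := card_greedy_of_notMem hoT fun h => ho (hsub h)
    have h1 : ∑ x ∈ S, ∑ y ∈ greedy g d j T, d x o
        ≤ ∑ x ∈ S, ∑ y ∈ greedy g d j T, (d x y + d y o) :=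
      Finset.sum_le_sum fun x _ => Finset.sum_le_sum fun y _ => hdtri x y o
    have h2 : ∑ x ∈ S, ∑ y ∈ greedy g d j T, d x y ≤ ∑ x ∈ S, ∑ y ∈ S, d x y :=
      Finset.sum_le_sum fun x _ =>
        Finset.sum_le_sum_of_subset_of_nonneg hsub fun _ _ _ => hdnn _ _
    simp only [Finset.sum_add_distrib, Finset.sum_const, nsmul_eq_mul, hcj, hcard] at h1
    rw [← Finset.mul_sum] at h1
    have h3 : ∑ y ∈ greedy g d j T, d y o ≤ gain g d (greedy g d j T) o := by
      unfold gain
      linarith [hgmono _ _ (Finset.subset_insert o (greedy g d j T))]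
    have h4 := mul_le_mul_of_nonneg_left h3 hkpos.le
    rw [sumsumDiv_eq_sum_sum hd0]
    linarith
  have hsum := Finset.sum_le_sum step
  rw [← Finset.sum_mul, Finset.sum_add_distrib, Finset.sum_const, Finset.card_range,
    nsmul_eq_mul, ← Finset.mul_sum] at hsum
  have hgauss : (∑ j ∈ Finset.range k, (j : ℝ)) * 2 = k * (k - 1) := by
    have := Finset.sum_range_id_mul_two k
    have h := congrArg (Nat.cast : ℕ → ℝ) this
    push_cast [Nat.cast_sub hk] at h
    exact h
  have hgain := mul_le_mul_of_nonneg_left (sum_gain_le_of_notMem hg0 hd0 hdsymm hoT ho) hkpos.le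
  have hg := mul_nonneg hkpos.le (hgnn S)
  have : (k : ℝ) * ((k - 1) * ∑ x ∈ S, d x o) ≤ k * (6 * (g S + sumsumDiv d S)) := by
    rw [← mul_assoc, ← hgauss]
    rw [← hS] at hgain
    linarith
  exact le_of_mul_le_mul_left this hkpos

/-- Any subset of `T` of size at most `k` can be moved injectively into the greedy set of `T`
at a small cost. -/
lemma exists_injOn_greedy
    (hgnn : ∀ S : Finset α, 0 ≤ g S)
    (hgmono : ∀ A B : Finset α, A ⊆ B → g A ≤ g B)
    (hg0 : g ∅ = 0) (hd0 : ∀ u, d u u = 0) (hdnn : ∀ u v, 0 ≤ d u v)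
    (hdsymm : ∀ u v, d u v = d v u) (hdtri : ∀ u v w, d u w ≤ d u v + d v w)
    {k : ℕ} (hk : 1 < k) {F : ℝ} (hF : 0 ≤ F) {T P : Finset α}
    (hPT : P ⊆ T) (hPk : P.card ≤ k)
    (hGF : (greedy g d k T).card = k →
      g (greedy g d k T) + sumsumDiv d (greedy g d k T) ≤ F) :
    ∃ h : α → α, Set.InjOn h P ∧ (∀ o ∈ P, h o ∈ greedy g d k T) ∧
      k * (k - 1) * ∑ o ∈ P, d o (h o) ≤ P.card * (6 * F) := by
  set S := greedy g d k T with hS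
  have hk1 : (0 : ℝ) < (k : ℝ) - 1 := by
    have : (1 : ℝ) < k := by exact_mod_cast hk
    linarith
  have hcoef : (0 : ℝ) ≤ k := Nat.cast_nonneg k
  by_cases hPS : P ⊆ S
  · refine ⟨id, Set.injOn_id _, hPS, ?_⟩
    simp only [id, hd0, Finset.sum_const_zero, mul_zero]
    positivity
  obtain ⟨o₁, ho₁P, ho₁S⟩ := Finset.not_subset.1 hPS
  have hcard : S.card = k := card_greedy_of_notMem (hPT ho₁P) ho₁S
  have hFS := hGF hcard
  have c1 := Finset.card_sdiff_add_card_inter P S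
  have c2 := Finset.card_sdiff_add_card_inter S P
  rw [Finset.inter_comm] at c2
  have hBpos : 0 < (P \ S).card := Finset.card_pos.2 ⟨o₁, Finset.mem_sdiff.2 ⟨ho₁P, ho₁S⟩⟩
  have hle : (P \ S).card ≤ (S \ P).card := by omega
  obtain ⟨h, hinj, hmaps, hcost⟩ := exists_injOn_card_mul_sum_le (P \ S) (S \ P) d hle
    (Finset.card_pos.1 (hBpos.trans_le hle))
  refine ⟨fun o => if o ∈ S then o else h o, ?_, ?_, ?_⟩
  · intro x hx y hy hxy
    rw [Finset.mem_coe] at hx hy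
    by_cases hxS : x ∈ S <;> by_cases hyS : y ∈ S <;> simp only [hxS, hyS, if_true, if_false] at hxy
    · exact hxy
    · have := hmaps y (Finset.mem_sdiff.2 ⟨hy, hyS⟩)
      rw [← hxy] at this
      exact absurd hx (Finset.mem_sdiff.1 this).2
    · have := hmaps x (Finset.mem_sdiff.2 ⟨hx, hxS⟩)
      rw [hxy] at this
      exact absurd hy (Finset.mem_sdiff.1 this).2
    · exact hinj (Finset.mem_coe.2 (Finset.mem_sdiff.2 ⟨hx, hxS⟩))
        (Finset.mem_coe.2 (Finset.mem_sdiff.2 ⟨hy, hyS⟩)) hxy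
  · intro o ho
    beta_reduce
    by_cases hoS : o ∈ S
    · rwa [if_pos hoS]
    · rw [if_neg hoS]
      exact (Finset.mem_sdiff.1 (hmaps o (Finset.mem_sdiff.2 ⟨ho, hoS⟩))).1
  · have hsplit : ∑ o ∈ P, d o (if o ∈ S then o else h o) = ∑ o ∈ P \ S, d o (h o) := by
      rw [← Finset.sum_subset (Finset.sdiff_subset : P \ S ⊆ P)]
      · refine Finset.sum_congr rfl fun o ho => ?_
        rw [if_neg (Finset.mem_sdiff.1 ho).2]
      · intro o ho hno
        have : o ∈ S := by
          by_contra hoS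
          exact hno (Finset.mem_sdiff.2 ⟨ho, hoS⟩)
        rw [if_pos this, hd0]
    rw [hsplit]
    set C := ∑ o ∈ P \ S, d o (h o) with hC
    have hbound : ((k : ℝ) - 1) * ∑ o ∈ P \ S, ∑ s ∈ S \ P, d o s
        ≤ (P \ S).card * (6 * F) := by
      rw [Finset.mul_sum, ← nsmul_eq_mul]
      refine Finset.sum_le_card_nsmul _ _ _ fun o ho => ?_
      have hoP := Finset.mem_sdiff.1 ho
      have h1 := mul_sum_dist_le_of_notMem hgnn hgmono hg0 hd0 hdnn hdsymm hdtri
        (hPT hoP.1) hoP.2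
      have h2 : ∑ s ∈ S \ P, d o s ≤ ∑ s ∈ S, d s o := by
        rw [Finset.sum_congr rfl fun s _ => hdsymm o s]
        exact Finset.sum_le_sum_of_subset_of_nonneg Finset.sdiff_subset fun _ _ _ => hdnn _ _
      have h3 := mul_le_mul_of_nonneg_left h2 hk1.le
      rw [← hS] at h1
      linarith
    have hcost' := mul_le_mul_of_nonneg_left hcost hk1.le
    have e1 : ((P \ S).card : ℝ) + (P ∩ S).card = P.card := by exact_mod_cast c1
    have e2 : ((S \ P).card : ℝ) + (P ∩ S).card = k := by rw [← hcard]; exact_mod_cast c2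
    have e3 : ((P \ S).card : ℝ) ≤ (S \ P).card := by exact_mod_cast hle
    have e4 : (0 : ℝ) < (S \ P).card := by exact_mod_cast hBpos.trans_le hle
    have e5 : (0 : ℝ) ≤ (P ∩ S).card := Nat.cast_nonneg _
    have hratio : (k : ℝ) * (P \ S).card ≤ (S \ P).card * P.card := by
      rw [← e1, ← e2]
      nlinarith
    have h6 : (0 : ℝ) ≤ 6 * F := by linarith
    have : ((S \ P).card : ℝ) * (k * (k - 1) * C) ≤ (S \ P).card * (P.card * (6 * F)) := by
      calc ((S \ P).card : ℝ) * (k * (k - 1) * C)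
          = k * ((k - 1) * ((S \ P).card * C)) := by ring
        _ ≤ k * ((P \ S).card * (6 * F)) :=
            mul_le_mul_of_nonneg_left (hcost'.trans hbound) hcoef
        _ = (k * (P \ S).card) * (6 * F) := by ring
        _ ≤ ((S \ P).card * P.card) * (6 * F) := mul_le_mul_of_nonneg_right hratio h6
        _ = _ := by ring
    exact le_of_mul_le_mul_left this e4

/-- The elements which the greedy algorithm rejects, when added one at a time to `T`, have
value at most twice that of the greedy solution. -/
lemma rejected_le_two_mul
    (hgmono : ∀ A B : Finset α, A ⊆ B → g A ≤ g B)
    (hgsub : ∀ A B : Finset α, A ⊆ B → ∀ y ∉ B,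
      g (insert y B) - g B ≤ g (insert y A) - g A)
    (hg0 : g ∅ = 0) (hd0 : ∀ u, d u u = 0) (hdnn : ∀ u v, 0 ≤ d u v)
    (hdsymm : ∀ u v, d u v = d v u) {k : ℕ} (hk : 0 < k) {T R : Finset α} {F : ℝ} (hF : 0 ≤ F)
    (hRk : R.card ≤ k) (hR : ∀ o ∈ R, o ∉ greedy g d k (insert o T))
    (hGF : (greedy g d k T).card = k →
      g (greedy g d k T) + sumsumDiv d (greedy g d k T) ≤ F) :
    g R ≤ 2 * F := by
  rcases R.eq_empty_or_nonempty with rfl | ⟨o₁, ho₁⟩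
  · rw [hg0]
    linarith
  have hcard : (greedy g d k T).card = k := by
    rw [← greedy_insert_of_notMem (hR o₁ ho₁)]
    exact card_greedy_of_notMem (Finset.mem_insert_self _ _) (hR o₁ ho₁)
  have hFS := hGF hcard
  have hD := sumsumDiv_nonneg hdnn (greedy g d k T)
  have hkpos : (0 : ℝ) < k := by exact_mod_cast hk
  have hmarg : ∀ o ∈ R, g (insert o (greedy g d k T)) - g (greedy g d k T) ≤ F / k := by
    intro o ho
    have h := mul_marginal_le_of_notMem hgsub hg0 hd0 hdnn hdsymm
      (Finset.mem_insert_self o T) (hR o ho)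
    rw [greedy_insert_of_notMem (hR o ho)] at h
    rw [le_div_iff₀ hkpos]
    linarith
  have h1 := hgmono _ _ (Finset.subset_union_right : R ⊆ greedy g d k T ∪ R)
  have h2 := union_le_add_sum_marginal hgmono hgsub (greedy g d k T) R
  have h3 := Finset.sum_le_card_nsmul _ _ _ hmarg
  rw [nsmul_eq_mul] at h3
  have h4 : (R.card : ℝ) * (F / k) ≤ k * (F / k) :=
    mul_le_mul_of_nonneg_right (by exact_mod_cast hRk) (by positivity)
  rw [mul_div_cancel₀ _ hkpos.ne'] at h4
  linarith

end Greedy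

section RandomPartition

lemma part_update {α : Type*} [Fintype α] [DecidableEq α] {m : ℕ} (π : α → Fin m) (o : α)
    (i : Fin m) : part (Function.update π o i) i = insert o (part π i) := by
  ext a
  by_cases h : a = o
  · subst h
    simp [part]
  · simp [part, h]

/-- Resampling one coordinate does not change a uniform average. -/
lemma sum_sum_update {α β : Type*} [Fintype α] [DecidableEq α] [Fintype β]
    (o : α) (φ : (α → β) → ℝ) :
    ∑ π : α → β, ∑ i : β, φ (Function.update π o i) = Fintype.card β * ∑ π : α → β, φ π := by
  have hconst : ∑ π : α → β, ∑ _i : β, φ π = Fintype.card β * ∑ π : α → β, φ π := by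
    simp [Finset.mul_sum]
  rw [← hconst, ← Fintype.sum_prod_type', ← Fintype.sum_prod_type']
  refine Finset.sum_nbij' (fun p => (Function.update p.1 o p.2, p.1 o))
    (fun p => (Function.update p.1 o p.2, p.1 o)) ?_ ?_ ?_ ?_ ?_ <;> simp

variable {α : Type*} [Fintype α] [LinearOrder α] {g : Finset α → ℝ} {d : α → α → ℝ}

lemma sumsumDiv_le_mul_of_forall_le
    (hgnn : ∀ S : Finset α, 0 ≤ g S)
    (hgmono : ∀ A B : Finset α, A ⊆ B → g A ≤ g B)
    (hg0 : g ∅ = 0) (hd0 : ∀ u, d u u = 0) (hdnn : ∀ u v, 0 ≤ d u v)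
    (hdsymm : ∀ u v, d u v = d v u) (hdtri : ∀ u v w, d u w ≤ d u v + d v w)
    {k m : ℕ} (hk : 10 ≤ k) {O : Finset α} (hO : O.card = k) (π : α → Fin m) {F : ℝ}
    (hF : 0 ≤ F)
    (hmax : ∀ R ⊆ Finset.univ.biUnion (fun i => greedy g d k (part π i)), R.card = k →
      g R + sumsumDiv d R ≤ F) :
    sumsumDiv d O ≤ 8.5 * F := by
  have hsub : ∀ i : Fin m, greedy g d k (part π i)
      ⊆ Finset.univ.biUnion (fun i => greedy g d k (part π i)) := fun i =>
    Finset.subset_biUnion_of_mem (fun i => greedy g d k (part π i)) (Finset.mem_univ i)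
  have hex : ∀ i : Fin m, _ := fun i =>
    exists_injOn_greedy (T := part π i) (P := O.filter fun o => π o = i)
      hgnn hgmono hg0 hd0 hdnn hdsymm hdtri (by omega : 1 < k) hF
      (Finset.filter_subset_filter _ (Finset.subset_univ O))
      ((Finset.card_filter_le _ _).trans hO.le) (hmax _ (hsub i))
  choose H hinj hmaps hcost using hex
  have hmem : ∀ o ∈ O, H (π o) o ∈ greedy g d k (part π (π o)) := fun o ho =>
    hmaps (π o) o (Finset.mem_filter.2 ⟨ho, rfl⟩)
  have hinjO : Set.InjOn (fun o => H (π o) o) O := by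
    intro x hx y hy hxy
    simp only at hxy
    have h1 := greedy_subset _ _ (hmem x hx)
    have h2 := greedy_subset _ _ (hmem y hy)
    simp only [part, Finset.mem_filter, Finset.mem_univ, true_and] at h1 h2
    have hπ : π x = π y := by rw [← h1, ← h2, hxy]
    rw [hπ] at hxy
    exact hinj (π y) (Finset.mem_coe.2 (Finset.mem_filter.2 ⟨hx, hπ⟩))
      (Finset.mem_coe.2 (Finset.mem_filter.2 ⟨hy, rfl⟩)) hxy
  have hD := sumsumDiv_le_of_injOn hd0 hdsymm hdtri hinjO
  have hI : g (O.image fun o => H (π o) o) + sumsumDiv d (O.image fun o => H (π o) o) ≤ F := by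
    refine hmax _ ?_ ((Finset.card_image_of_injOn hinjO).trans hO)
    intro y hy
    obtain ⟨o, ho, rfl⟩ := Finset.mem_image.1 hy
    exact hsub _ (hmem o ho)
  have htotal : (k : ℝ) * (k - 1) * ∑ o ∈ O, d o (H (π o) o) ≤ k * (6 * F) := by
    have hc : (k : ℝ) = ∑ i : Fin m, ((O.filter fun o => π o = i).card : ℝ) := by
      rw [← hO, Finset.card_eq_sum_card_fiberwise (f := π) (t := Finset.univ) (by simp)]
      push_cast
      rfl
    rw [← Finset.sum_fiberwise O π, Finset.mul_sum]
    conv_rhs => rw [hc, Finset.sum_mul]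
    refine Finset.sum_le_sum fun i _ => ?_
    refine le_trans (le_of_eq ?_) (hcost i)
    congr 1
    refine Finset.sum_congr rfl fun o ho => ?_
    rw [(Finset.mem_filter.1 ho).2]
  rw [hO] at hD
  have hk' : (10 : ℝ) ≤ k := by exact_mod_cast hk
  have hX : (0 : ℝ) ≤ k * ∑ o ∈ O, d o (H (π o) o) :=
    mul_nonneg (by linarith) (Finset.sum_nonneg fun _ _ => hdnn _ _)
  have hg := hgnn (O.image fun o => H (π o) o)
  set X := (k : ℝ) * ∑ o ∈ O, d o (H (π o) o) with hXdef
  have h1 : ((k : ℝ) - 1) * X ≤ k * (6 * F) := by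
    rw [hXdef]
    linarith
  have h2 : X ≤ 7.5 * F := by
    by_contra hcon
    push Not at hcon
    nlinarith
  linarith

lemma le_three_mul_expVal
    (hgmono : ∀ A B : Finset α, A ⊆ B → g A ≤ g B)
    (hgsub : ∀ A B : Finset α, A ⊆ B → ∀ y ∉ B,
      g (insert y B) - g B ≤ g (insert y A) - g A)
    (hg0 : g ∅ = 0) (hd0 : ∀ u, d u u = 0) (hdnn : ∀ u v, 0 ≤ d u v)
    (hdsymm : ∀ u v, d u v = d v u)
    {k m : ℕ} (hk : 0 < k) (hm : 0 < m) {O : Finset α} (hO : O.card = k)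
    (F : (α → Fin m) → ℝ) (hF : ∀ π, 0 ≤ F π)
    (hcard : ∀ π : α → Fin m,
      k ≤ (Finset.univ.biUnion (fun i => greedy g d k (part π i))).card)
    (hmax : ∀ π : α → Fin m,
      ∀ R ⊆ Finset.univ.biUnion (fun i => greedy g d k (part π i)), R.card = k →
        g R + sumsumDiv d R ≤ F π) :
    g O ≤ 3 * expVal m F := by
  obtain ⟨δ, hδO, hδ⟩ := exists_modular_le hgsub hg0 O
  have hsub : ∀ (π : α → Fin m) (i : Fin m), greedy g d k (part π i)
      ⊆ Finset.univ.biUnion (fun i => greedy g d k (part π i)) := fun π i =>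
    Finset.subset_biUnion_of_mem (fun i => greedy g d k (part π i)) (Finset.mem_univ i)
  let rej : α → (α → Fin m) → ℝ := fun o π =>
    if o ∉ greedy g d k (part π (π o)) then δ o else 0
  have hsel : ∀ π, ∑ o ∈ O, (δ o - rej o π) ≤ F π := by
    intro π
    set A := O.filter fun o => o ∈ greedy g d k (part π (π o)) with hA
    have hsum : ∑ o ∈ O, (δ o - rej o π) = ∑ o ∈ A, δ o := by
      rw [hA, Finset.sum_filter]
      refine Finset.sum_congr rfl fun o _ => ?_
      by_cases h : o ∈ greedy g d k (part π (π o)) <;> simp [rej, h]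
    have hAsub : A ⊆ Finset.univ.biUnion (fun i => greedy g d k (part π i)) := fun o ho =>
      hsub π _ (Finset.mem_filter.1 ho).2
    obtain ⟨R, hAR, hRU, hRk⟩ := Finset.exists_subsuperset_card_eq hAsub
      ((Finset.card_filter_le _ _).trans hO.le) (hcard π)
    rw [hsum]
    linarith [hδ A (Finset.filter_subset _ _), hgmono _ _ hAR, hmax π R hRU hRk,
      sumsumDiv_nonneg hdnn R]
  have hrej : ∀ (π : α → Fin m) (i : Fin m),
      ∑ o ∈ O, rej o (Function.update π o i) ≤ 2 * F π := by
    intro π i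
    set R := O.filter fun o => o ∉ greedy g d k (insert o (part π i)) with hR
    have hsum : ∑ o ∈ O, rej o (Function.update π o i) = ∑ o ∈ R, δ o := by
      rw [hR, Finset.sum_filter]
      refine Finset.sum_congr rfl fun o _ => ?_
      simp only [rej, Function.update_self, part_update]
    rw [hsum]
    exact (hδ R (Finset.filter_subset _ _)).trans
      (rejected_le_two_mul hgmono hgsub hg0 hd0 hdnn hdsymm hk (hF π)
        ((Finset.card_filter_le _ _).trans hO.le)
        (fun o ho => (Finset.mem_filter.1 ho).2) (hmax π _ (hsub π i)))
  have hmpos : (0 : ℝ) < m := by exact_mod_cast hm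
  have h1 : (m : ℝ) * ∑ π, ∑ o ∈ O, rej o π ≤ m * (2 * ∑ π, F π) := by
    have e1 : (m : ℝ) * ∑ π, ∑ o ∈ O, rej o π
        = ∑ π, ∑ i, ∑ o ∈ O, rej o (Function.update π o i) := by
      rw [Finset.sum_comm, Finset.mul_sum]
      simp only [Finset.sum_comm (s := (Finset.univ : Finset (Fin m))) (t := O)]
      rw [Finset.sum_comm (t := O)]
      refine Finset.sum_congr rfl fun o _ => ?_
      rw [sum_sum_update o (rej o), Fintype.card_fin]
    have e2 : (m : ℝ) * (2 * ∑ π, F π) = ∑ π, ∑ _i : Fin m, 2 * F π := by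
      simp [Finset.mul_sum]
    rw [e1, e2]
    exact Finset.sum_le_sum fun π _ => Finset.sum_le_sum fun i _ => hrej π i
  have h2 := le_of_mul_le_mul_left h1 hmpos
  have h3 := Finset.sum_le_sum fun π (_ : π ∈ Finset.univ) => hsel π
  simp only [Finset.sum_sub_distrib, hδO] at h3
  rw [Finset.sum_const, Finset.card_univ, Fintype.card_fun, Fintype.card_fin, nsmul_eq_mul] at h3
  unfold expVal
  rw [← mul_div_assoc, le_div_iff₀ (by positivity)]
  push_cast at h3
  linarith

end RandomPartition

/-- Lemma 3, combining Lemmas 2, 5 and 6: with `(T¹, …, Tᵐ)` a uniformly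
random `m`-partition of the finite ground set, `Sⁱ = greedy(Tⁱ)` the output of
Algorithm 1 on each part, `O` a `k`-subset maximizing `f = g + D` over all `k`-subsets,
and `OPT(∪ᵢ Sⁱ)` a `k`-subset of `∪ᵢ Sⁱ` maximizing `f` there:
`g(O) ≤ 7·E[f(OPT(∪ᵢ Sⁱ))]`, `D(O) ≤ 8.5·f(OPT(∪ᵢ Sⁱ))` for every realization of the
partition, and `f(O) ≤ 15.5·E[f(OPT(∪ᵢ Sⁱ))]`. -/
theorem stmt16 {α : Type*} [Fintype α] [DecidableEq α] [LinearOrder α]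
    (g : Finset α → ℝ)
    (hgnn : ∀ S : Finset α, 0 ≤ g S)
    (hgmono : ∀ A B : Finset α, A ⊆ B → g A ≤ g B)
    (hgsub : ∀ A B : Finset α, A ⊆ B → ∀ y ∉ B,
      g (insert y B) - g B ≤ g (insert y A) - g A)
    (hg0 : g ∅ = 0)
    (d : α → α → ℝ)
    (hd0 : ∀ u, d u u = 0) (hdnn : ∀ u v, 0 ≤ d u v)
    (hdsymm : ∀ u v, d u v = d v u)
    (hdtri : ∀ u v w, d u w ≤ d u v + d v w)
    (k m : ℕ) (hk : 10 ≤ k) (hm : 1 ≤ m)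
    (O : Finset α) (hOcard : O.card = k)
    (hOmax : ∀ R : Finset α, R.card = k →
      g R + sumsumDiv d R ≤ g O + sumsumDiv d O)
    (OPT : (α → Fin m) → Finset α)
    (hOPT : ∀ π : α → Fin m,
      OPT π ⊆ Finset.univ.biUnion (fun i => greedy g d k (part π i)) ∧
      (OPT π).card = k ∧
      ∀ R ⊆ Finset.univ.biUnion (fun i => greedy g d k (part π i)), R.card = k →
        g R + sumsumDiv d R ≤ g (OPT π) + sumsumDiv d (OPT π)) :
    g O ≤ 7 * expVal m (fun π => g (OPT π) + sumsumDiv d (OPT π)) ∧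
    (∀ π : α → Fin m, sumsumDiv d O ≤ 8.5 * (g (OPT π) + sumsumDiv d (OPT π))) ∧
    g O + sumsumDiv d O
      ≤ 15.5 * expVal m (fun π => g (OPT π) + sumsumDiv d (OPT π)) := by
  obtain rfl : ‹DecidableEq α› = LinearOrder.toDecidableEq := Subsingleton.elim _ _
  have hF : ∀ π, 0 ≤ g (OPT π) + sumsumDiv d (OPT π) := fun π =>
    add_nonneg (hgnn _) (sumsumDiv_nonneg hdnn _)
  have hG := le_three_mul_expVal hgmono hgsub hg0 hd0 hdnn hdsymm (by omega : 0 < k)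
    (by omega : 0 < m) hOcard (fun π => g (OPT π) + sumsumDiv d (OPT π)) hF
    (fun π => (hOPT π).2.1.symm.le.trans (Finset.card_le_card (hOPT π).1)) (fun π => (hOPT π).2.2)
  have hD : ∀ π : α → Fin m, sumsumDiv d O ≤ 8.5 * (g (OPT π) + sumsumDiv d (OPT π)) :=
    fun π => sumsumDiv_le_mul_of_forall_le hgnn hgmono hg0 hd0 hdnn hdsymm hdtri hk hOcard π
      (hF π) (hOPT π).2.2
  have hmpos : (0 : ℝ) < (m : ℝ) ^ Fintype.card α := by
    have : (0 : ℝ) < m := by exact_mod_cast hm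
    positivity
  have hE : 0 ≤ expVal m (fun π => g (OPT π) + sumsumDiv d (OPT π)) :=
    div_nonneg (Finset.sum_nonneg fun π _ => hF π) hmpos.le
  have hED : sumsumDiv d O ≤ 8.5 * expVal m (fun π => g (OPT π) + sumsumDiv d (OPT π)) := by
    have h := Finset.sum_le_sum fun π (_ : π ∈ Finset.univ) => hD π
    rw [Finset.sum_const, Finset.card_univ, Fintype.card_fun, Fintype.card_fin, nsmul_eq_mul,
      ← Finset.mul_sum] at h
    unfold expVal
    rw [← mul_div_assoc, le_div_iff₀ hmpos]
    push_cast at h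
    linarith
  refine ⟨by linarith, hD, by linarith⟩
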